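/- arXiv:1710.05981 — 7 statements merged into one kernel-verified Lean document; each statement's English description precedes it below -/
import Mathlib

section
/- For any probability vector (p_s)_{s∈𝒮} over strategies, any chosen strategy Z ∈ 𝒮, and any rewards as in the setup, the second moment of the average strategy scores satisfies Σ_{s∈𝒮} p_s·(ḡ′_s)² ≤ ḡ′_Z, where ḡ′_Z is the average strategy score of the chosen strategy Z. -/
open Finset Real

/-- Under the same setup as Statement 0, the second moment of the average
strategy scores satisfies `∑_{s∈𝒮} p s · (g' s)² ≤ g' Z`. -/
theorem stmt_1
    (K l : ℕ) (hK : 1 ≤ K) (hl : 1 ≤ l) (hlK : l ≤ K)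
    (𝒮 : Finset (Finset (Fin K))) (h𝒮 : 𝒮 = Finset.powersetCard l Finset.univ)
    (p : Finset (Fin K) → ℝ)
    (hp0 : ∀ s ∈ 𝒮, 0 ≤ p s) (hp1 : ∑ s ∈ 𝒮, p s = 1)
    (q : Fin K → ℝ) (hq : ∀ k, q k = ∑ s ∈ 𝒮.filter (fun s => k ∈ s), p s)
    (hqpos : ∀ k, 0 < q k)
    (Z : Finset (Fin K)) (hZ : Z ∈ 𝒮)
    (fbar : Fin K → ℝ) (hfbar : ∀ k, fbar k ∈ Set.Icc (0 : ℝ) (1 / l))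
    (hfbar0 : ∀ k ∉ Z, fbar k = 0)
    (f' : Fin K → ℝ) (hf' : ∀ k, f' k = if k ∈ Z then (1 / l - fbar k) / q k else 0)
    (g' : Finset (Fin K) → ℝ) (hg' : ∀ s, g' s = ∑ k ∈ s, f' k) :
    ∑ s ∈ 𝒮, p s * (g' s) ^ 2 ≤ g' Z := by
  have hl0 : (0 : ℝ) < l := by exact_mod_cast hl
  have hjensen : ∀ s ∈ 𝒮, p s * (g' s) ^ 2 ≤ p s * (l * ∑ k ∈ s, (f' k) ^ 2) := by
    intro s hs
    have hcard : s.card = l := by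
      rw [h𝒮, Finset.mem_powersetCard] at hs
      exact hs.2
    refine mul_le_mul_of_nonneg_left ?_ (hp0 s hs)
    rw [hg', ← hcard]
    exact sq_sum_le_card_mul_sum_sq
  have hswap : ∑ s ∈ 𝒮, p s * (l * ∑ k ∈ s, (f' k) ^ 2) = ∑ k, l * (q k * (f' k) ^ 2) := by
    simp_rw [hq, Finset.sum_mul, Finset.mul_sum]
    rw [Finset.sum_comm' (t' := Finset.univ) (s' := fun k => 𝒮.filter (fun s => k ∈ s))
      (by simp)]
    exact Finset.sum_congr rfl fun k _ => Finset.sum_congr rfl fun s _ => by ring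
  have hterm : ∀ k, l * (q k * (f' k) ^ 2) ≤ f' k := by
    intro k
    rw [hf']
    split_ifs
    · obtain ⟨h0, h1⟩ := hfbar k
      have hle : l * (1 / l - fbar k) ≤ 1 := by
        rw [mul_sub, mul_one_div_cancel hl0.ne']
        linarith [mul_nonneg hl0.le h0]
      have hqk := hqpos k
      calc l * (q k * ((1 / l - fbar k) / q k) ^ 2)
          = l * (1 / l - fbar k) * ((1 / l - fbar k) / q k) := by
            generalize (1 / (l : ℝ) - fbar k) = a
            field_simp
        _ ≤ (1 / l - fbar k) / q k :=
            mul_le_of_le_one_left (div_nonneg (sub_nonneg.2 h1) hqk.le) hle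
    · simp
  calc ∑ s ∈ 𝒮, p s * (g' s) ^ 2
      ≤ ∑ s ∈ 𝒮, p s * (l * ∑ k ∈ s, (f' k) ^ 2) := Finset.sum_le_sum hjensen
    _ = ∑ k, l * (q k * (f' k) ^ 2) := hswap
    _ ≤ ∑ k, f' k := Finset.sum_le_sum fun k _ => hterm k
    _ = g' Z := by
      rw [hg']
      refine (Finset.sum_subset (Finset.subset_univ Z) fun k _ hk => ?_).symm
      rw [hf', if_neg hk]
end

section
/- In SpecWatch-II, for any realization of the chosen strategies and rewards, the following deterministic inequality holds: (J − Ḡ_II) − min_{s∈𝒮} Σ_{j=1}^J ḡ′_{s,j} ≤ (η/2)·Σ_{j=1}^J ḡ′_{Z_j,j} + (ln S)/η, where Ḡ_II = Σ_{j=1}^J ḡ_{Z_j,j}. -/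
open Finset Real

theorem exp_neg_le_quadratic {x : ℝ} (hx : 0 ≤ x) : Real.exp (-x) ≤ 1 - x + x ^ 2 / 2 := by
  have h := Real.quadratic_le_exp_of_nonneg hx
  have hpos : 0 < 1 - x + x ^ 2 / 2 := by nlinarith [sq_nonneg (x - 1)]
  rw [Real.exp_neg, inv_le_iff_one_le_mul₀ (Real.exp_pos x)]
  calc (1 : ℝ) ≤ (1 - x + x ^ 2 / 2) * (1 + x + x ^ 2 / 2) := by nlinarith [sq_nonneg (x ^ 2)]
    _ ≤ (1 - x + x ^ 2 / 2) * Real.exp x := mul_le_mul_of_nonneg_left h hpos.le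

/-- One step of the exponential-weights potential argument: for a weighting `p` of total mass one
and losses bounded by `M` with mean at most one, the second moment of the loss is at most `M`. -/
theorem sum_mul_exp_neg_le {ι : Type*} (A : Finset ι) (p g : ι → ℝ) {η M : ℝ} (hη : 0 ≤ η)
    (hp : ∀ s ∈ A, 0 ≤ p s) (hsum : ∑ s ∈ A, p s = 1) (hg : ∀ s ∈ A, 0 ≤ g s)
    (hgM : ∀ s ∈ A, g s ≤ M) (hM : 0 ≤ M) (hmean : ∑ s ∈ A, p s * g s ≤ 1) :
    ∑ s ∈ A, p s * Real.exp (-η * g s) ≤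
      Real.exp (-η * (∑ s ∈ A, p s * g s) + η ^ 2 / 2 * M) := by
  have hterm : ∀ s ∈ A, p s * Real.exp (-η * g s) ≤
      p s - η * (p s * g s) + η ^ 2 / 2 * M * (p s * g s) := by
    intro s hs
    have h1 : Real.exp (-η * g s) ≤ 1 - η * g s + (η * g s) ^ 2 / 2 := by
      rw [neg_mul]
      exact exp_neg_le_quadratic (mul_nonneg hη (hg s hs))
    have h2 : η ^ 2 / 2 * (p s * g s) * g s ≤ η ^ 2 / 2 * (p s * g s) * M :=
      mul_le_mul_of_nonneg_left (hgM s hs)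
        (mul_nonneg (by positivity) (mul_nonneg (hp s hs) (hg s hs)))
    have h3 := mul_le_mul_of_nonneg_left h1 (hp s hs)
    linarith
  have h := Finset.sum_le_sum hterm
  rw [Finset.sum_add_distrib, Finset.sum_sub_distrib, ← Finset.mul_sum, ← Finset.mul_sum,
    hsum] at h
  have h4 : η ^ 2 / 2 * M * ∑ s ∈ A, p s * g s ≤ η ^ 2 / 2 * M :=
    mul_le_of_le_one_right (by positivity) hmean
  have h5 := Real.add_one_le_exp (-η * (∑ s ∈ A, p s * g s) + η ^ 2 / 2 * M)
  linarith

/-- The mean over sets of an additive score is the sum of scores against the marginals. -/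
theorem sum_mul_sum_eq_sum_marginal {α : Type*} [Fintype α] [DecidableEq α]
    (A : Finset (Finset α)) (p : Finset α → ℝ) (f : α → ℝ) :
    ∑ s ∈ A, p s * ∑ k ∈ s, f k = ∑ k, (∑ s ∈ A.filter (fun s => k ∈ s), p s) * f k := by
  have h : ∀ s ∈ A, p s * ∑ k ∈ s, f k = ∑ k, if k ∈ s then p s * f k else 0 := by
    intro s _
    rw [Finset.mul_sum, ← Finset.sum_filter, Finset.filter_mem_eq_inter, Finset.univ_inter]
  rw [Finset.sum_congr rfl h, Finset.sum_comm]
  refine Finset.sum_congr rfl fun k _ => ?_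
  rw [Finset.sum_mul, Finset.sum_filter]

/-- In SpecWatch-II, for any realization of the chosen strategies and rewards,
`(J − Ḡ_II) − min_{s∈𝒮} ∑_{j=1}^J g' j s ≤ (η/2)·∑_{j=1}^J g' j (Z j) + (ln S)/η`, where
`Ḡ_II = ∑_{j=1}^J ∑_{k ∈ Z j} fbar k j`. -/
theorem stmt_4
    (K l J : ℕ) (hK : 1 ≤ K) (hl : 1 ≤ l) (hlK : l ≤ K) (hJ : 1 ≤ J)
    (η : ℝ) (hη : 0 < η)
    (𝒮 : Finset (Finset (Fin K))) (h𝒮 : 𝒮 = Finset.powersetCard l Finset.univ)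
    (h𝒮ne : 𝒮.Nonempty)
    (Z : ℕ → Finset (Fin K)) (hZ : ∀ j, Z j ∈ 𝒮)
    (fbar : Fin K → ℕ → ℝ) (hfbar : ∀ k j, fbar k j ∈ Set.Icc (0 : ℝ) (1 / l))
    (hfbar0 : ∀ k j, k ∉ Z j → fbar k j = 0)
    (w : ℕ → Finset (Fin K) → ℝ) (W : ℕ → ℝ)
    (p : ℕ → Finset (Fin K) → ℝ) (q : ℕ → Fin K → ℝ)
    (f' : ℕ → Fin K → ℝ) (g' : ℕ → Finset (Fin K) → ℝ)
    (hw1 : ∀ s, w 1 s = 1)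
    (hwrec : ∀ j s, w (j + 1) s = w j s * Real.exp (-η * g' j s))
    (hW : ∀ j, W j = ∑ s ∈ 𝒮, w j s)
    (hp : ∀ j s, p j s = w j s / W j)
    (hq : ∀ j k, q j k = ∑ s ∈ 𝒮.filter (fun s => k ∈ s), p j s)
    (hf' : ∀ j k, f' j k = if k ∈ Z j then (1 / l - fbar k j) / q j k else 0)
    (hg' : ∀ j s, g' j s = ∑ k ∈ s, f' j k) :
    ((J : ℝ) - ∑ j ∈ Finset.Icc 1 J, ∑ k ∈ Z j, fbar k j) -
        (𝒮.inf' h𝒮ne fun s => ∑ j ∈ Finset.Icc 1 J, g' j s) ≤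
      η / 2 * ∑ j ∈ Finset.Icc 1 J, g' j (Z j) + Real.log 𝒮.card / η := by
  have hl0 : (0 : ℝ) < l := by exact_mod_cast hl
  have hwexp : ∀ n s, w (n + 1) s = Real.exp (-η * ∑ j ∈ Finset.Icc 1 n, g' j s) := by
    intro n s
    induction n with
    | zero => simp [hw1]
    | succ n ih =>
      rw [hwrec, ih, Finset.sum_Icc_succ_top (Nat.le_add_left 1 n), mul_add, Real.exp_add]
  have hwpos : ∀ n s, 0 < w (n + 1) s := fun n s => hwexp n s ▸ Real.exp_pos _
  have hWpos : ∀ n, 0 < W (n + 1) := fun n => by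
    rw [hW]
    exact Finset.sum_pos (fun s _ => hwpos n s) h𝒮ne
  have hppos : ∀ n s, 0 < p (n + 1) s := fun n s => by
    rw [hp]
    exact div_pos (hwpos n s) (hWpos n)
  have hpsum : ∀ n, ∑ s ∈ 𝒮, p (n + 1) s = 1 := fun n => by
    simp_rw [hp]
    rw [← Finset.sum_div, ← hW, div_self (hWpos n).ne']
  have hqpos : ∀ n, ∀ k ∈ Z (n + 1), 0 < q (n + 1) k := fun n k hk => by
    rw [hq]
    exact Finset.sum_pos (fun s _ => hppos n s)
      ⟨Z (n + 1), Finset.mem_filter.mpr ⟨hZ _, hk⟩⟩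
  have hfnonneg : ∀ n k, 0 ≤ f' (n + 1) k := fun n k => by
    rw [hf']
    split_ifs with hk
    · exact div_nonneg (sub_nonneg.mpr (hfbar k _).2) (hqpos n k hk).le
    · exact le_rfl
  have hgnonneg : ∀ n s, 0 ≤ g' (n + 1) s := fun n s => by
    rw [hg']
    exact Finset.sum_nonneg fun k _ => hfnonneg n k
  have hgle : ∀ n s, g' (n + 1) s ≤ g' (n + 1) (Z (n + 1)) := fun n s => by
    rw [hg', hg', ← Finset.sum_inter_add_sum_sdiff s (Z (n + 1))]
    have hzero : ∑ k ∈ s \ Z (n + 1), f' (n + 1) k = 0 :=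
      Finset.sum_eq_zero fun k hk => by rw [hf', if_neg (Finset.mem_sdiff.mp hk).2]
    rw [hzero, add_zero]
    exact Finset.sum_le_sum_of_subset_of_nonneg Finset.inter_subset_right
      fun k _ _ => hfnonneg n k
  have hmean : ∀ n, ∑ s ∈ 𝒮, p (n + 1) s * g' (n + 1) s =
      1 - ∑ k ∈ Z (n + 1), fbar k (n + 1) := fun n => by
    have hcard : (Z (n + 1)).card = l := (Finset.mem_powersetCard.mp (h𝒮 ▸ hZ (n + 1))).2
    have hchan : ∀ k, q (n + 1) k * f' (n + 1) k =
        if k ∈ Z (n + 1) then 1 / (l : ℝ) - fbar k (n + 1) else 0 := fun k => by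
      rw [hf']
      split_ifs with hk
      · exact mul_div_cancel₀ _ (hqpos n k hk).ne'
      · exact mul_zero _
    simp_rw [hg']
    rw [sum_mul_sum_eq_sum_marginal]
    simp_rw [← hq, hchan]
    rw [← Finset.sum_filter, Finset.filter_mem_eq_inter, Finset.univ_inter,
      Finset.sum_sub_distrib, Finset.sum_const, hcard, nsmul_eq_mul, mul_one_div_cancel hl0.ne']
  have hstep : ∀ n, W (n + 1 + 1) ≤ W (n + 1) *
      Real.exp (-η * (1 - ∑ k ∈ Z (n + 1), fbar k (n + 1)) +
        η ^ 2 / 2 * g' (n + 1) (Z (n + 1))) := fun n => by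
    have hWratio : W (n + 1 + 1) =
        W (n + 1) * ∑ s ∈ 𝒮, p (n + 1) s * Real.exp (-η * g' (n + 1) s) := by
      rw [hW (n + 1 + 1), Finset.mul_sum]
      refine Finset.sum_congr rfl fun s _ => ?_
      rw [hwrec, hp, ← mul_assoc, mul_div_cancel₀ _ (hWpos n).ne']
    rw [hWratio, ← hmean]
    refine mul_le_mul_of_nonneg_left ?_ (hWpos n).le
    refine sum_mul_exp_neg_le 𝒮 _ _ hη.le (fun s _ => (hppos n s).le) (hpsum n)
      (fun s _ => hgnonneg n s) (fun s _ => hgle n s) (hgnonneg n _) ?_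
    rw [hmean]
    exact sub_le_self _ (Finset.sum_nonneg fun k _ => (hfbar k _).1)
  have hWbound : ∀ n, W (n + 1) ≤ 𝒮.card *
      Real.exp (-η * (n - ∑ j ∈ Finset.Icc 1 n, ∑ k ∈ Z j, fbar k j) +
        η ^ 2 / 2 * ∑ j ∈ Finset.Icc 1 n, g' j (Z j)) := by
    intro n
    induction n with
    | zero => simp [hW, hw1]
    | succ n ih =>
      refine (hstep n).trans ((mul_le_mul_of_nonneg_right ih (Real.exp_pos _).le).trans_eq ?_)
      rw [Finset.sum_Icc_succ_top (Nat.le_add_left 1 n),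
        Finset.sum_Icc_succ_top (Nat.le_add_left 1 n), mul_assoc, ← Real.exp_add]
      congr 2
      push_cast
      ring
  obtain ⟨s, hs, hsmin⟩ := Finset.exists_mem_eq_inf' h𝒮ne
    fun s => ∑ j ∈ Finset.Icc 1 J, g' j s
  rw [hsmin]
  have hcardpos : (0 : ℝ) < 𝒮.card := by exact_mod_cast h𝒮ne.card_pos
  have hlower : w (J + 1) s ≤ W (J + 1) := by
    rw [hW]
    exact Finset.single_le_sum (fun t _ => (hwpos J t).le) hs
  have hlog := Real.log_le_log (hwpos J s) (hlower.trans (hWbound J))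
  rw [hwexp, Real.log_exp, Real.log_mul hcardpos.ne' (Real.exp_pos _).ne', Real.log_exp] at hlog
  rw [← sub_le_iff_le_add', le_div_iff₀ hη]
  linarith
end

section
/- Let I be a {0,1}-valued random variable with P[I = 1] = q for some q ∈ (0,1], and let ϕ ∈ [0,1] and β ∈ (0,1] be constants. Then E[exp(β·(ϕ − (I·ϕ + β)/q))] ≤ 1. -/
open MeasureTheory Real

/-- A second-order upper bound for the exponential on the nonpositive half-line. -/
theorem exp_neg_le_one_sub_add_sq {u : ℝ} (hu : 0 ≤ u) : exp (-u) ≤ 1 - u + u ^ 2 := by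
  have hpos : 0 < 1 + u := by linarith
  calc exp (-u) = (exp u)⁻¹ := exp_neg u
    _ ≤ (1 + u)⁻¹ := inv_anti₀ hpos (by linarith [add_one_le_exp u])
    _ ≤ 1 - u + u ^ 2 := by
      rw [inv_le_iff_one_le_mul₀ hpos]
      nlinarith [pow_nonneg hu 3]

/-- The expectation of a function of a `{0,1}`-valued random variable. -/
theorem integral_comp_of_zero_or_one {Ω : Type*} [MeasurableSpace Ω] (P : Measure Ω)
    [IsProbabilityMeasure P] {I : Ω → ℝ} (hI : Measurable I) (hI01 : ∀ ω, I ω = 0 ∨ I ω = 1)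
    (f : ℝ → ℝ) :
    ∫ ω, f (I ω) ∂P = f 0 + P.real {ω | I ω = 1} * (f 1 - f 0) := by
  have hs : MeasurableSet {ω | I ω = 1} := hI (measurableSet_singleton 1)
  have hf : ∀ ω, f (I ω) = f 0 + {ω | I ω = 1}.indicator (fun _ => f 1 - f 0) ω := by
    intro ω
    rcases hI01 ω with h | h <;> simp [h]
  simp_rw [hf]
  rw [integral_add (integrable_const _) ((integrable_const _).indicator hs),
    integral_indicator_const _ hs]
  simp

/-- Let `I` be a `{0,1}`-valued random variable with `P[I = 1] = q` for some
`q ∈ (0,1]`, and let `φ ∈ [0,1]` and `β ∈ (0,1]` be constants. Then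
`E[exp(β·(φ − (I·φ + β)/q))] ≤ 1`. -/
theorem stmt_8
    {Ω : Type*} [MeasurableSpace Ω] (P : Measure Ω) [IsProbabilityMeasure P]
    (I : Ω → ℝ) (hImeas : Measurable I) (hI01 : ∀ ω, I ω = 0 ∨ I ω = 1)
    (q : ℝ) (hq : q ∈ Set.Ioc (0 : ℝ) 1)
    (hPq : P {ω | I ω = 1} = ENNReal.ofReal q)
    (φ β : ℝ) (hφ : φ ∈ Set.Icc (0 : ℝ) 1) (hβ : β ∈ Set.Ioc (0 : ℝ) 1) :
    (∫ ω, Real.exp (β * (φ - (I ω * φ + β) / q)) ∂P) ≤ 1 := by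
  obtain ⟨hq0, -⟩ := hq
  obtain ⟨hφ0, hφ1⟩ := hφ
  obtain ⟨hβ0, -⟩ := hβ
  have hreal : P.real {ω | I ω = 1} = q := by
    rw [measureReal_def, hPq, ENNReal.toReal_ofReal hq0.le]
  rw [integral_comp_of_zero_or_one P hImeas hI01 fun x => exp (β * (φ - (x * φ + β) / q)), hreal]
  have hx : 0 ≤ β * φ := by positivity
  have hfactor : exp (β * (φ - (1 * φ + β) / q)) =
      exp (β * (φ - (0 * φ + β) / q)) * exp (-(β * φ / q)) := by
    rw [← exp_add]
    ring_nf
  have hmgf : 1 - q + q * exp (-(β * φ / q)) ≤ exp (-(β * φ) + (β * φ) ^ 2 / q) :=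
    calc 1 - q + q * exp (-(β * φ / q))
        ≤ 1 - q + q * (1 - β * φ / q + (β * φ / q) ^ 2) := by
          gcongr
          exact exp_neg_le_one_sub_add_sq (by positivity)
      _ = -(β * φ) + (β * φ) ^ 2 / q + 1 := by field_simp; ring
      _ ≤ _ := add_one_le_exp _
  have hsq : (β * φ) ^ 2 / q ≤ β ^ 2 / q := by
    gcongr
    exact mul_le_of_le_one_right hβ0.le hφ1
  calc _ = exp (β * (φ - (0 * φ + β) / q)) * (1 - q + q * exp (-(β * φ / q))) := by
        rw [hfactor]; ring
    _ ≤ exp (β * (φ - (0 * φ + β) / q)) * exp (-(β * φ) + (β * φ) ^ 2 / q) := by gcongr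
    _ = exp ((β * φ) ^ 2 / q - β ^ 2 / q) := by
        rw [← exp_add]
        ring_nf
    _ ≤ 1 := exp_le_one_iff.2 (by linarith)
end

section
/- Under SpecWatch-III (with strategies drawn at random according to the algorithm's probabilities), for every channel k ∈ {1,…,K}, every n ∈ {1,…,J}, every β ∈ (0,1), and every δ ∈ (0,1): P[ Σ_{j=1}^n ϕ_{k,j} ≥ Σ_{j=1}^n f̄′_{k,j} + (1/β)·ln(K/δ) ] ≤ δ/K. -/
open Finset Real MeasureTheory

/-- The (finite) strategy space carries the discrete σ-algebra. -/
instance finsetDiscreteMeasurableSpace (α : Type*) : MeasurableSpace (Finset α) := ⊤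

lemma Real.exp_le_one_add_add_sq {y : ℝ} (hy : y ≤ 1) : Real.exp y ≤ 1 + y + y ^ 2 := by
  rcases le_total (-1) y with h | h
  · have := abs_le.1 (Real.abs_exp_sub_one_sub_id_le (abs_le.2 ⟨h, hy⟩))
    linarith [this.2]
  · have : Real.exp y ≤ 1 := Real.exp_le_one_iff.2 (by linarith)
    nlinarith

/-- The moment generating function of an importance-weighted Bernoulli variable, centred and
shifted by the exploration bonus, is at most one. -/
lemma importance_weighted_mgf_le_one {β x q : ℝ} (hβ : β ∈ Set.Ioo (0 : ℝ) 1)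
    (hx : x ∈ Set.Icc (0 : ℝ) 1) (hq : 0 < q) (hq1 : q ≤ 1) :
    Real.exp (β * (x - β / q)) * (1 - q) + Real.exp (β * (x - (x + β) / q)) * q ≤ 1 := by
  obtain ⟨hβ0, hβ1⟩ := hβ
  obtain ⟨hx0, hx1⟩ := hx
  have hβx : β * x ≤ 1 := by nlinarith
  have e0 : Real.exp (β * (x - β / q)) = Real.exp (-(β ^ 2 / q)) * Real.exp (β * x) := by
    rw [← Real.exp_add]; congr 1; ring
  have e1 : Real.exp (β * (x - (x + β) / q)) =
      Real.exp (-(β ^ 2 / q)) * Real.exp (β * x - β * x / q) := by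
    rw [← Real.exp_add]; congr 1; ring
  have h0 := Real.exp_le_one_add_add_sq hβx
  have h1 : Real.exp (β * x - β * x / q) ≤
      1 + (β * x - β * x / q) + (β * x - β * x / q) ^ 2 :=
    Real.exp_le_one_add_add_sq (by have : 0 ≤ β * x / q := by positivity
                                   linarith)
  have hx2 : x ^ 2 ≤ 1 := by nlinarith
  have key : Real.exp (β * x) * (1 - q) + Real.exp (β * x - β * x / q) * q ≤
      1 + β ^ 2 / q := by
    calc _ ≤ (1 + β * x + (β * x) ^ 2) * (1 - q) +
          (1 + (β * x - β * x / q) + (β * x - β * x / q) ^ 2) * q := by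
          gcongr
      _ = 1 + β ^ 2 / q * x ^ 2 - (β * x) ^ 2 := by field_simp; ring
      _ ≤ 1 + β ^ 2 / q * 1 - 0 := by gcongr; positivity
      _ = _ := by ring
  have h2 : 1 + β ^ 2 / q ≤ Real.exp (β ^ 2 / q) := by
    linarith [Real.add_one_le_exp (β ^ 2 / q)]
  calc _ = Real.exp (-(β ^ 2 / q)) *
        (Real.exp (β * x) * (1 - q) + Real.exp (β * x - β * x / q) * q) := by
        rw [e0, e1]; ring
    _ ≤ Real.exp (-(β ^ 2 / q)) * Real.exp (β ^ 2 / q) := by gcongr; exact key.trans h2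
    _ = 1 := by rw [← Real.exp_add]; simp

/-- One step of the exponential supermartingale: multiplying a bounded nonnegative past-measurable
factor by the exponential of the estimation error does not increase its expectation. -/
lemma integral_mul_exp_importance_weighted_le {Ω : Type*} {m mΩ : MeasurableSpace Ω}
    {P : Measure Ω} [IsProbabilityMeasure P] (hm : m ≤ mΩ) {β B : ℝ}
    (hβ : β ∈ Set.Ioo (0 : ℝ) 1) {M x q a : Ω → ℝ}
    (hM : Measurable[m] M) (hx : Measurable[m] x) (hq : Measurable[m] q) (ha : Measurable[mΩ] a)
    (hM0 : ∀ ω, 0 ≤ M ω) (hMB : ∀ ω, M ω ≤ B) (hx01 : ∀ ω, x ω ∈ Set.Icc (0 : ℝ) 1)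
    (hq0 : ∀ ω, 0 < q ω) (ha01 : ∀ ω, a ω = 0 ∨ a ω = 1) (hcond : P[a | m] =ᵐ[P] q) :
    ∫ ω, M ω * Real.exp (β * (x ω - (a ω * x ω + β) / q ω)) ∂P ≤ ∫ ω, M ω ∂P := by
  have hβ0 := hβ.1
  set F0 : Ω → ℝ := fun ω => Real.exp (β * (x ω - β / q ω)) with hF0
  set F1 : Ω → ℝ := fun ω => Real.exp (β * (x ω - (x ω + β) / q ω)) with hF1
  have hF0m : Measurable[m] F0 :=
    Real.measurable_exp.comp ((hx.sub (measurable_const.div hq)).const_mul β)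
  have hF1m : Measurable[m] F1 :=
    Real.measurable_exp.comp ((hx.sub ((hx.add measurable_const).div hq)).const_mul β)
  have bound {y r : ℝ} (hy : y ≤ 1) (hr : 0 ≤ r) : Real.exp (β * (y - r)) ≤ Real.exp β :=
    Real.exp_le_exp.2 (by nlinarith)
  have hF0b ω : F0 ω ≤ Real.exp β := bound (hx01 ω).2 (div_nonneg hβ0.le (hq0 ω).le)
  have hF1b ω : F1 ω ≤ Real.exp β :=
    bound (hx01 ω).2 (div_nonneg (add_nonneg (hx01 ω).1 hβ0.le) (hq0 ω).le)
  have hB : ∀ ω, 0 ≤ B := fun ω => (hM0 ω).trans (hMB ω)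
  have hMi : Integrable M P := Integrable.of_bound (hM.mono hm le_rfl).aestronglyMeasurable B
    (.of_forall fun ω => by rw [Real.norm_eq_abs, abs_of_nonneg (hM0 ω)]; exact hMB ω)
  set V : Ω → ℝ := fun ω => M ω * (F1 ω - F0 ω) with hV
  have hVm : Measurable[m] V := hM.mul (hF1m.sub hF0m)
  have hVb ω : |V ω| ≤ B * Real.exp β := by
    rw [hV, abs_mul, abs_of_nonneg (hM0 ω)]
    have h0 : 0 ≤ F0 ω := (Real.exp_pos _).le
    have h1 : 0 ≤ F1 ω := (Real.exp_pos _).le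
    exact mul_le_mul (hMB ω) (abs_le.2 ⟨by linarith [hF0b ω], by linarith [hF1b ω]⟩)
      (abs_nonneg _) (hB ω)
  have hai : Integrable a P := Integrable.of_bound ha.aestronglyMeasurable 1
    (.of_forall fun ω => by rcases ha01 ω with h | h <;> simp [h])
  have hVa : Integrable (V * a) P :=
    hai.bdd_mul (hVm.mono hm le_rfl).aestronglyMeasurable (.of_forall hVb)
  have hMF0 : Integrable (fun ω => M ω * F0 ω) P :=
    hMi.mul_bdd (c := Real.exp β) (hF0m.mono hm le_rfl).aestronglyMeasurable (.of_forall fun ω => by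
      rw [Real.norm_eq_abs, abs_of_nonneg (Real.exp_pos _).le]; exact hF0b ω)
  have hpull : P[V * a | m] =ᵐ[P] V * q :=
    (condExp_mul_of_stronglyMeasurable_left hVm.stronglyMeasurable hVa hai).trans
      (hcond.mono fun ω h => by simp [h])
  have hVq : Integrable (V * q) P := integrable_condExp.congr hpull
  have hint : ∫ ω, (V * a) ω ∂P = ∫ ω, (V * q) ω ∂P := by
    rw [← integral_condExp hm]; exact integral_congr_ae hpull
  have hq1 : ∀ᵐ ω ∂P, q ω ≤ 1 := by
    have h := condExp_mono (m := m) hai (integrable_const (1 : ℝ))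
      (.of_forall fun ω => by rcases ha01 ω with h | h <;> simp [h])
    rw [condExp_const hm] at h
    filter_upwards [h, hcond] with ω h1 h2
    rwa [h2] at h1
  calc _ = ∫ ω, (M ω * F0 ω + (V * a) ω) ∂P := by
        congr 1 with ω
        rcases ha01 ω with h | h <;> simp [h, hV, hF0, hF1]
        ring
    _ = ∫ ω, (M ω * F0 ω + (V * q) ω) ∂P := by
        rw [integral_add hMF0 hVa, integral_add hMF0 hVq, hint]
    _ ≤ ∫ ω, M ω ∂P := by
        refine integral_mono_ae (hMF0.add hVq) hMi ?_
        filter_upwards [hq1] with ω h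
        have := mul_le_mul_of_nonneg_left
          (importance_weighted_mgf_le_one hβ (hx01 ω) (hq0 ω) h) (hM0 ω)
        simp only [hV, hF0, hF1, Pi.mul_apply]
        linarith

/-- Under SpecWatch-III (strategies drawn according to the algorithm's
probabilities), for every channel `k`, every `n ∈ {1,…,J}`, every `β ∈ (0,1)` and every
`δ ∈ (0,1)`:
`P[∑_{j=1}^n φ k j ≥ ∑_{j=1}^n f' j k + (1/β)·ln(K/δ)] ≤ δ/K`. -/
theorem stmt_9
    (K l J : ℕ) (hK : 1 ≤ K) (hl : 1 ≤ l) (hlK : l ≤ K) (hJ : 1 ≤ J)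
    (𝒮 : Finset (Finset (Fin K))) (h𝒮 : 𝒮 = Finset.powersetCard l Finset.univ)
    (𝒞 : Finset (Finset (Fin K))) (h𝒞sub : 𝒞 ⊆ 𝒮)
    (h𝒞cover : ∀ k : Fin K, ∃ s ∈ 𝒞, k ∈ s)
    (γ β η : ℝ) (hγ : γ ∈ Set.Ioo (0 : ℝ) 1) (hβ : β ∈ Set.Ioo (0 : ℝ) 1) (hη : 0 < η)
    {Ω : Type*} [MeasurableSpace Ω] (P : Measure Ω) [IsProbabilityMeasure P]
    (Z : ℕ → Ω → Finset (Fin K)) (hZmeas : ∀ j, Measurable (Z j))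
    (hZ : ∀ j ω, Z j ω ∈ 𝒮)
    (φ : Fin K → ℕ → Ω → ℝ) (hφ : ∀ k j ω, φ k j ω ∈ Set.Icc (0 : ℝ) 1)
    (w : ℕ → Finset (Fin K) → Ω → ℝ) (W : ℕ → Ω → ℝ)
    (p : ℕ → Finset (Fin K) → Ω → ℝ) (q : ℕ → Fin K → Ω → ℝ)
    (f' : ℕ → Fin K → Ω → ℝ) (g' : ℕ → Finset (Fin K) → Ω → ℝ)
    (hw1 : ∀ s ω, w 1 s ω = 1)
    (hwrec : ∀ j s ω, w (j + 1) s ω = w j s ω * Real.exp (η * g' j s ω))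
    (hW : ∀ j ω, W j ω = ∑ s ∈ 𝒮, w j s ω)
    (hp : ∀ j s ω, p j s ω =
      (1 - γ) * w j s ω / W j ω + γ / 𝒞.card * (if s ∈ 𝒞 then 1 else 0))
    (hq : ∀ j k ω, q j k ω = ∑ s ∈ 𝒮.filter (fun s => k ∈ s), p j s ω)
    (hf' : ∀ j k ω, f' j k ω = ((if k ∈ Z j ω then φ k j ω else 0) + β) / q j k ω)
    (hg' : ∀ j s ω, g' j s ω = ∑ k ∈ s, f' j k ω)
    -- `𝒢 j` is the history σ-algebra before batch `j`, generated by `Z 1, …, Z (j−1)`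
    (𝒢 : ℕ → MeasurableSpace Ω)
    (h𝒢 : ∀ j, 𝒢 j = MeasurableSpace.comap
      (fun ω => fun i : Fin (j - 1) => Z (i + 1) ω) MeasurableSpace.pi)
    (hadapt : ∀ k j, Measurable[𝒢 j] (φ k j))
    -- `P[Z j = s | Z 1, …, Z (j−1)] = p j s`
    (hcond : ∀ j ∈ Finset.Icc 1 J, ∀ s ∈ 𝒮,
      (P[Set.indicator {ω' | Z j ω' = s} (fun _ => (1 : ℝ)) | 𝒢 j]) =ᵐ[P] p j s)
    (δ : ℝ) (hδ : δ ∈ Set.Ioo (0 : ℝ) 1) :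
    ∀ k : Fin K, ∀ n ∈ Finset.Icc 1 J,
      P {ω | ∑ j ∈ Finset.Icc 1 n, φ k j ω ≥
          (∑ j ∈ Finset.Icc 1 n, f' j k ω) + 1 / β * Real.log (K / δ)} ≤
        ENNReal.ofReal (δ / K) := by
  obtain ⟨hγ0, hγ1⟩ := hγ
  have hdisc (t : Set (Finset (Fin K))) : MeasurableSet t := trivial
  have hZ𝒢 {i j : ℕ} (hi : 1 ≤ i) (hij : i < j) : Measurable[𝒢 j] (Z i) := by
    rw [h𝒢]
    have h := (measurable_pi_apply (X := fun _ : Fin (j - 1) => Finset (Fin K))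
      ⟨i - 1, by omega⟩).comp (comap_measurable
        (fun ω => fun i : Fin (j - 1) => Z (i + 1) ω))
    have e : i - 1 + 1 = i := by omega
    simpa [Function.comp_def, e] using h
  have h𝒢le j : 𝒢 j ≤ ‹MeasurableSpace Ω› := by
    rw [h𝒢]
    exact (measurable_pi_lambda _ fun i => hZmeas _).comap_le
  have h𝒢succ j : 𝒢 j ≤ 𝒢 (j + 1) := by
    rw [h𝒢 j]
    exact Measurable.comap_le
      (@measurable_pi_lambda _ _ _ (𝒢 (j + 1)) _ _ fun i => hZ𝒢 (by omega) (by have := i.2; omega))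
  have hwpos : ∀ j, 1 ≤ j → ∀ s ω, 0 < w j s ω := by
    intro j hj
    induction j, hj using Nat.le_induction with
    | base => simp [hw1]
    | succ j hj ih => intro s ω; rw [hwrec]; exact mul_pos (ih s ω) (Real.exp_pos _)
  have hbase {j : ℕ} (hj : 1 ≤ j) (s : Finset (Fin K)) (ω : Ω) :
      0 ≤ (1 - γ) * w j s ω / W j ω :=
    div_nonneg (mul_nonneg (by linarith) (hwpos j hj s ω).le)
      (by rw [hW]; exact Finset.sum_nonneg fun s _ => (hwpos j hj s ω).le)
  have hqpos {j : ℕ} (hj : 1 ≤ j) (k : Fin K) (ω : Ω) : 0 < q j k ω := by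
    rw [hq]
    obtain ⟨s, hs, hks⟩ := h𝒞cover k
    refine Finset.sum_pos' (fun t _ => ?_) ⟨s, by simp [h𝒞sub hs, hks], ?_⟩
    · rw [hp]
      have := hbase hj t ω
      positivity
    · rw [hp, if_pos hs]
      have hc : (0 : ℝ) < 𝒞.card := by exact_mod_cast Finset.card_pos.2 ⟨s, hs⟩
      have := hbase hj s ω
      positivity
  have hqmeas {j : ℕ} (h : ∀ s, Measurable[𝒢 j] (w j s)) (k : Fin K) :
      Measurable[𝒢 j] (q j k) := by
    have hWm : Measurable[𝒢 j] (W j) := by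
      rw [show W j = fun ω => ∑ s ∈ 𝒮, w j s ω from funext (hW j)]
      exact Finset.measurable_fun_sum _ fun s _ => h s
    rw [show q j k = fun ω => ∑ s ∈ 𝒮.filter (fun s => k ∈ s), p j s ω from funext (hq j k)]
    refine Finset.measurable_fun_sum _ fun s _ => ?_
    rw [show p j s = fun ω => (1 - γ) * w j s ω / W j ω +
      γ / 𝒞.card * (if s ∈ 𝒞 then 1 else 0) from funext (hp j s)]
    exact (((h s).const_mul _).div hWm).add measurable_const
  have hfmeas {j : ℕ} (hj : 1 ≤ j) (h : ∀ s, Measurable[𝒢 j] (w j s)) (k : Fin K) :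
      Measurable[𝒢 (j + 1)] (f' j k) := by
    rw [show f' j k = fun ω => ((if k ∈ Z j ω then φ k j ω else 0) + β) / q j k ω from
      funext (hf' j k)]
    have hset : MeasurableSet[𝒢 (j + 1)] {ω | k ∈ Z j ω} :=
      hZ𝒢 hj (Nat.lt_succ_self j) (t := {s | k ∈ s}) (hdisc _)
    exact ((Measurable.ite hset ((hadapt k j).mono (h𝒢succ j) le_rfl) measurable_const).add
      measurable_const).div ((hqmeas h k).mono (h𝒢succ j) le_rfl)
  have hwmeas : ∀ j, 1 ≤ j → ∀ s, Measurable[𝒢 j] (w j s) := by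
    intro j hj
    induction j, hj using Nat.le_induction with
    | base =>
      intro s
      rw [show w 1 s = fun _ => 1 from funext (hw1 s)]
      exact measurable_const
    | succ j hj ih =>
      intro s
      rw [show w (j + 1) s = fun ω => w j s ω * Real.exp (η * ∑ k ∈ s, f' j k ω) from
        funext fun ω => by rw [hwrec, hg']]
      exact ((ih s).mono (h𝒢succ j) le_rfl).mul (Real.measurable_exp.comp
        ((Finset.measurable_fun_sum _ fun k _ => hfmeas hj ih k).const_mul η))
  intro k n hn
  have hβ0 := hβ.1
  set M : ℕ → Ω → ℝ := fun n ω =>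
    Real.exp (β * ∑ j ∈ Finset.Icc 1 n, (φ k j ω - f' j k ω)) with hMdef
  have hMmeas n : Measurable[𝒢 (n + 1)] (M n) := by
    refine Real.measurable_exp.comp (Measurable.const_mul
      (Finset.measurable_fun_sum _ fun j hj => ?_) β)
    rw [Finset.mem_Icc] at hj
    have hmono : Monotone 𝒢 := monotone_nat_of_le_succ h𝒢succ
    exact ((hadapt k j).mono (hmono (by omega)) le_rfl).sub
      ((hfmeas hj.1 (hwmeas j hj.1) k).mono (hmono (by omega)) le_rfl)
  have hMB n ω : M n ω ≤ Real.exp (β * n) := by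
    refine Real.exp_le_exp.2 (mul_le_mul_of_nonneg_left ?_ hβ0.le)
    have : ∑ j ∈ Finset.Icc 1 n, (φ k j ω - f' j k ω) ≤ ∑ j ∈ Finset.Icc 1 n, (1 : ℝ) := by
      refine Finset.sum_le_sum fun j hj => ?_
      have h1 := hφ k j ω
      have : 0 ≤ f' j k ω := by
        rw [hf']
        refine div_nonneg (add_nonneg ?_ hβ0.le) (hqpos (Finset.mem_Icc.1 hj).1 k ω).le
        split_ifs
        exacts [h1.1, le_rfl]
      linarith [h1.2]
    simpa using this
  have hMint : ∀ n ≤ J, ∫ ω, M n ω ∂P ≤ 1 := by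
    intro n
    induction n with
    | zero => intro _; simp [hMdef]
    | succ n ih =>
      intro hn
      refine le_trans ?_ (ih (by omega))
      have hsum : (fun ω => if k ∈ Z (n + 1) ω then (1 : ℝ) else 0) =
          ∑ s ∈ 𝒮.filter (fun s => k ∈ s),
            Set.indicator {ω' | Z (n + 1) ω' = s} (fun _ => (1 : ℝ)) := by
        ext ω
        simp [Finset.sum_apply, Set.indicator_apply, hZ]
      have hind s : MeasurableSet {ω' | Z (n + 1) ω' = s} :=
        hZmeas (n + 1) (t := {s}) (hdisc _)
      have hcondk : P[fun ω => if k ∈ Z (n + 1) ω then (1 : ℝ) else 0 | 𝒢 (n + 1)]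
          =ᵐ[P] q (n + 1) k := by
        rw [hsum]
        refine (condExp_finsetSum (fun s _ =>
          (integrable_const (1 : ℝ)).indicator (hind s)) _).trans ?_
        have hall : ∀ᵐ ω ∂P, ∀ s ∈ 𝒮,
            (P[Set.indicator {ω' | Z (n + 1) ω' = s} (fun _ => (1 : ℝ)) | 𝒢 (n + 1)]) ω =
              p (n + 1) s ω :=
          (Finset.eventually_all _).2 fun s hs =>
            hcond (n + 1) (Finset.mem_Icc.2 ⟨by omega, hn⟩) s hs
        filter_upwards [hall] with ω h
        rw [Finset.sum_apply, hq]
        exact Finset.sum_congr rfl fun s hs => h s (Finset.mem_filter.1 hs).1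
      have hset : MeasurableSet {ω | k ∈ Z (n + 1) ω} :=
        hZmeas (n + 1) (t := {s | k ∈ s}) (hdisc _)
      have hstep : M (n + 1) = fun ω => M n ω * Real.exp (β * (φ k (n + 1) ω -
          ((if k ∈ Z (n + 1) ω then (1 : ℝ) else 0) * φ k (n + 1) ω + β) / q (n + 1) k ω)) := by
        funext ω
        simp only [hMdef]
        rw [← Real.exp_add, Finset.sum_Icc_succ_top (by omega), hf', mul_add]
        simp
      rw [hstep]
      exact integral_mul_exp_importance_weighted_le (h𝒢le (n + 1)) hβ (hMmeas n)
        (hadapt k (n + 1)) (hqmeas (hwmeas (n + 1) (by omega)) k)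
        (Measurable.ite hset measurable_const measurable_const)
        (fun ω => (Real.exp_pos _).le) (hMB n) (hφ k (n + 1)) (hqpos (by omega) k)
        (fun ω => by split_ifs <;> simp) hcondk
  have hKpos : (0 : ℝ) < K := by exact_mod_cast hK
  have hKδ : 0 < K / δ := div_pos hKpos hδ.1
  have hMi : Integrable (M n) P :=
    Integrable.of_bound ((hMmeas n).mono (h𝒢le _) le_rfl).aestronglyMeasurable
      (Real.exp (β * n)) (.of_forall fun ω => by
        rw [Real.norm_eq_abs, abs_of_nonneg (Real.exp_pos _).le]; exact hMB n ω)
  have hmarkov := (mul_meas_ge_le_integral_of_nonneg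
    (.of_forall fun ω => (Real.exp_pos _).le) hMi (K / δ)).trans
      (hMint n (Finset.mem_Icc.1 hn).2)
  refine (measure_mono (t := {ω | K / δ ≤ M n ω}) fun ω hω => ?_).trans
    ((ENNReal.le_ofReal_iff_toReal_le (measure_ne_top _ _)
      (div_nonneg hδ.1.le hKpos.le)).2 ?_)
  · rw [Set.mem_ofPred_eq, ← Real.log_le_iff_le_exp hKδ, Finset.sum_sub_distrib]
    have h : 1 / β * Real.log (K / δ) ≤
        ∑ j ∈ Finset.Icc 1 n, φ k j ω - ∑ j ∈ Finset.Icc 1 n, f' j k ω := by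
      have := hω.out
      linarith
    rwa [one_div_mul_eq_div, div_le_iff₀' hβ0] at h
  · have e : δ / K = 1 / (K / δ) := by rw [one_div_div]
    rw [e, le_div_iff₀' hKδ]
    exact hmarkov
end

section
/- For any probability vector (p_s)_{s∈𝒮} over strategies, any chosen strategy Z ∈ 𝒮, any β ∈ (0,1), any covering strategy set 𝒞 ⊆ 𝒮, and any rewards as in the setup, the second moment of the SpecWatch-III strategy scores satisfies Σ_{s∈𝒮} p_s·(ḡ′_s)² ≤ l·(1+β)·Σ_{s∈𝒞} ḡ′_s. -/
open Finset Real

theorem sum_mul_sum_mem_eq_sum_mul {α R : Type*} [Fintype α] [DecidableEq α]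
    [NonUnitalNonAssocSemiring R] (A : Finset (Finset α)) (w : Finset α → R) (f : α → R) :
    ∑ s ∈ A, w s * ∑ k ∈ s, f k = ∑ k, (∑ s ∈ A with k ∈ s, w s) * f k := by
  simp_rw [Finset.mul_sum, Finset.sum_mul]
  exact Finset.sum_comm' (by simp)

theorem sum_univ_le_sum_sum_of_cover {α : Type*} [Fintype α] [DecidableEq α]
    {C : Finset (Finset α)} (hC : ∀ k, ∃ s ∈ C, k ∈ s) {f : α → ℝ} (hf : ∀ k, 0 ≤ f k) :
    ∑ k, f k ≤ ∑ s ∈ C, ∑ k ∈ s, f k := by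
  have h := sum_mul_sum_mem_eq_sum_mul C (fun _ => (1 : ℝ)) f
  simp only [one_mul] at h
  rw [h]
  refine Finset.sum_le_sum fun k _ => le_mul_of_one_le_left (hf k) ?_
  obtain ⟨s, hs, hk⟩ := hC k
  exact Finset.single_le_sum (f := fun _ => (1 : ℝ)) (fun _ _ => zero_le_one)
    (Finset.mem_filter.2 ⟨hs, hk⟩)

/-- Under the setup of Statement 11, with a covering strategy set `𝒞 ⊆ 𝒮`
(every channel lies in some strategy of `𝒞`), the second moment of the SpecWatch-III
strategy scores satisfies `∑_{s∈𝒮} p s · (g' s)² ≤ l·(1+β)·∑_{s∈𝒞} g' s`. -/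
theorem stmt_12
    (K l : ℕ) (hK : 1 ≤ K) (hl : 1 ≤ l) (hlK : l ≤ K)
    (𝒮 : Finset (Finset (Fin K))) (h𝒮 : 𝒮 = Finset.powersetCard l Finset.univ)
    (𝒞 : Finset (Finset (Fin K))) (h𝒞sub : 𝒞 ⊆ 𝒮)
    (h𝒞cover : ∀ k : Fin K, ∃ s ∈ 𝒞, k ∈ s)
    (β : ℝ) (hβ : β ∈ Set.Ioo (0 : ℝ) 1)
    (p : Finset (Fin K) → ℝ)
    (hp0 : ∀ s ∈ 𝒮, 0 ≤ p s) (hp1 : ∑ s ∈ 𝒮, p s = 1)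
    (q : Fin K → ℝ) (hq : ∀ k, q k = ∑ s ∈ 𝒮.filter (fun s => k ∈ s), p s)
    (hqpos : ∀ k, 0 < q k)
    (Z : Finset (Fin K)) (hZ : Z ∈ 𝒮)
    (fbar : Fin K → ℝ) (hfbar : ∀ k, fbar k ∈ Set.Icc (0 : ℝ) 1)
    (hfbar0 : ∀ k ∉ Z, fbar k = 0)
    (f' : Fin K → ℝ)
    (hf' : ∀ k, f' k = ((if k ∈ Z then fbar k else 0) + β) / q k)
    (g' : Finset (Fin K) → ℝ) (hg' : ∀ s, g' s = ∑ k ∈ s, f' k) :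
    ∑ s ∈ 𝒮, p s * (g' s) ^ 2 ≤ l * (1 + β) * ∑ s ∈ 𝒞, g' s := by
  obtain ⟨hβ0, -⟩ := hβ
  have hnum0 (k : Fin K) : 0 ≤ (if k ∈ Z then fbar k else 0) + β := by
    have := (hfbar k).1
    split_ifs <;> linarith
  have hnum1 (k : Fin K) : (if k ∈ Z then fbar k else 0) + β ≤ 1 + β := by
    have := (hfbar k).2
    split_ifs <;> linarith
  have hf0 (k : Fin K) : 0 ≤ f' k := by
    rw [hf']
    exact div_nonneg (hnum0 k) (hqpos k).le
  have hqf (k : Fin K) : q k * f' k ≤ 1 + β := by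
    rw [hf', mul_div_cancel₀ _ (hqpos k).ne']
    exact hnum1 k
  calc ∑ s ∈ 𝒮, p s * (g' s) ^ 2
      ≤ ∑ s ∈ 𝒮, l * (p s * ∑ k ∈ s, f' k ^ 2) := by
        refine Finset.sum_le_sum fun s hs => ?_
        have hcard : s.card = l := (Finset.mem_powersetCard.1 (h𝒮 ▸ hs)).2
        rw [hg', mul_left_comm, ← hcard]
        exact mul_le_mul_of_nonneg_left sq_sum_le_card_mul_sum_sq (hp0 s hs)
    _ = l * ∑ k, q k * f' k ^ 2 := by
        simp_rw [← Finset.mul_sum, sum_mul_sum_mem_eq_sum_mul, ← hq]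
    _ ≤ l * ∑ k, (1 + β) * f' k := by
        refine mul_le_mul_of_nonneg_left (Finset.sum_le_sum fun k _ => ?_) l.cast_nonneg
        rw [sq, ← mul_assoc]
        exact mul_le_mul_of_nonneg_right (hqf k) (hf0 k)
    _ = l * (1 + β) * ∑ k, f' k := by rw [← Finset.mul_sum, mul_assoc]
    _ ≤ l * (1 + β) * ∑ s ∈ 𝒞, g' s := by
        simp_rw [hg']
        gcongr
        exact sum_univ_le_sum_sum_of_cover h𝒞cover hf0
end

section
/- In SpecWatch-III, if γ ∈ (0,1/2), β ∈ (0,1), and η > 0 satisfies 2·η·l·C ≤ γ, then the total weight after J batches satisfies ln(W_{J+1}/W_1) ≤ (η/(1−γ))·(Ḡ_III + J·K·β) + (η²·l·(1+β)/(1−γ))·Σ_{j=1}^J Σ_{s∈𝒞} ḡ′_{s,j}, where Ḡ_III = Σ_{j=1}^J ḡ_{Z_j,j}. -/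
open Finset Real

/-- The log-ratio of an exponentially reweighted sum is at most the weighted mean of the
exponents plus their weighted second moment. -/
lemma log_sum_mul_exp_div_sum_le {α : Type*} (S : Finset α) (hS : S.Nonempty) (w x : α → ℝ)
    (hw : ∀ s ∈ S, 0 < w s) (hx0 : ∀ s ∈ S, 0 ≤ x s) (hx1 : ∀ s ∈ S, x s ≤ 1) :
    Real.log ((∑ s ∈ S, w s * Real.exp (x s)) / ∑ s ∈ S, w s) ≤
      ∑ s ∈ S, w s / (∑ t ∈ S, w t) * (x s + x s ^ 2) := by
  have hW : 0 < ∑ s ∈ S, w s := Finset.sum_pos hw hS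
  have hpos : 0 < ∑ s ∈ S, w s * Real.exp (x s) :=
    Finset.sum_pos (fun s hs => mul_pos (hw s hs) (Real.exp_pos _)) hS
  have hle : ∑ s ∈ S, w s * Real.exp (x s) ≤
      ∑ s ∈ S, w s + ∑ s ∈ S, w s * (x s + x s ^ 2) := by
    rw [← Finset.sum_add_distrib]
    refine Finset.sum_le_sum fun s hs => ?_
    have h := Real.abs_exp_sub_one_sub_id_le (x := x s)
      (by rw [abs_of_nonneg (hx0 s hs)]; exact hx1 s hs)
    have h' := (abs_le.mp h).2
    nlinarith [hw s hs]
  refine (Real.log_le_sub_one_of_pos (div_pos hpos hW)).trans ?_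
  have hrw : ∑ s ∈ S, w s / (∑ t ∈ S, w t) * (x s + x s ^ 2) =
      (∑ s ∈ S, w s * (x s + x s ^ 2)) / ∑ t ∈ S, w t := by
    rw [Finset.sum_div]
    exact Finset.sum_congr rfl fun s _ => by ring
  rw [hrw, sub_le_iff_le_add, div_add_one hW.ne']
  exact div_le_div_of_nonneg_right (by linarith) hW.le

/-- Exchanging the order of summation over sets and their elements. -/
lemma sum_mul_sum_mem_eq {ι : Type*} [Fintype ι] [DecidableEq ι] (S : Finset (Finset ι))
    (p : Finset ι → ℝ) (a : ι → ℝ) :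
    ∑ s ∈ S, p s * ∑ k ∈ s, a k = ∑ k, (∑ s ∈ S.filter (fun s => k ∈ s), p s) * a k := by
  simp_rw [Finset.mul_sum, Finset.sum_mul]
  refine Finset.sum_comm' fun s k => ?_
  simp

/-- A nonnegative function is summed at least once over a family of sets covering its domain. -/
lemma sum_le_sum_sum_of_cover {ι : Type*} [Fintype ι] [DecidableEq ι] (C : Finset (Finset ι))
    (hC : ∀ k, ∃ s ∈ C, k ∈ s) (a : ι → ℝ) (ha : ∀ k, 0 ≤ a k) :
    ∑ k, a k ≤ ∑ s ∈ C, ∑ k ∈ s, a k := by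
  have h := sum_mul_sum_mem_eq C (fun _ => 1) a
  simp only [one_mul] at h
  rw [h]
  refine Finset.sum_le_sum fun k _ => ?_
  obtain ⟨s, hs, hk⟩ := hC k
  refine le_mul_of_one_le_left (ha k) ?_
  exact Finset.single_le_sum (f := fun _ => (1 : ℝ)) (fun _ _ => zero_le_one)
    (Finset.mem_filter.mpr ⟨hs, hk⟩)

/-- One batch of exponential weighting: `w` are the weights, `p` their mixture with the uniform
distribution on a cover `C`, `q` the induced channel probabilities, `r k / q k` the
importance-weighted scores of biased rewards `r`. -/
lemma log_weight_ratio_le {ι : Type*} [Fintype ι] [DecidableEq ι] (S C : Finset (Finset ι))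
    (l : ℕ) (hSl : ∀ s ∈ S, s.card = l) (hS : S.Nonempty) (hCS : C ⊆ S) (hCne : C.Nonempty)
    (hC : ∀ k, ∃ s ∈ C, k ∈ s) (γ η B : ℝ) (hγ0 : 0 < γ) (hγ1 : γ < 1) (hη : 0 < η)
    (hηB : η * (l * B) * C.card ≤ γ) (w p : Finset ι → ℝ) (q r : ι → ℝ)
    (hw : ∀ s, 0 < w s)
    (hp : ∀ s, p s = (1 - γ) * w s / (∑ t ∈ S, w t) + γ / C.card * (if s ∈ C then 1 else 0))
    (hq : ∀ k, q k = ∑ s ∈ S.filter (fun s => k ∈ s), p s)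
    (hr0 : ∀ k, 0 ≤ r k) (hrB : ∀ k, r k ≤ B) :
    Real.log ((∑ s ∈ S, w s * Real.exp (η * ∑ k ∈ s, r k / q k)) / ∑ s ∈ S, w s) ≤
      η / (1 - γ) * ∑ k, r k +
        η ^ 2 * l * B / (1 - γ) * ∑ s ∈ C, ∑ k ∈ s, r k / q k := by
  have hW : 0 < ∑ s ∈ S, w s := Finset.sum_pos (fun s _ => hw s) hS
  have hCc : (0 : ℝ) < C.card := by exact_mod_cast hCne.card_pos
  have hγ' : 0 < 1 - γ := by linarith
  have hpw : ∀ s, (1 - γ) * w s / (∑ t ∈ S, w t) ≤ p s := fun s => by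
    rw [hp]
    exact le_add_of_nonneg_right (by positivity)
  have hp0 : ∀ s, 0 ≤ p s := fun s =>
    (div_nonneg (mul_nonneg hγ'.le (hw s).le) hW.le).trans (hpw s)
  have hqγ : ∀ k, γ / C.card ≤ q k := fun k => by
    obtain ⟨s, hs, hk⟩ := hC k
    have h1 : γ / C.card ≤ p s := by
      rw [hp, if_pos hs, mul_one]
      exact le_add_of_nonneg_left (div_nonneg (mul_nonneg hγ'.le (hw s).le) hW.le)
    rw [hq]
    exact h1.trans (Finset.single_le_sum (f := p) (fun t _ => hp0 t)
      (Finset.mem_filter.mpr ⟨hCS hs, hk⟩))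
  have hq0 : ∀ k, 0 < q k := fun k => (div_pos hγ0 hCc).trans_le (hqγ k)
  have hf0 : ∀ k, 0 ≤ r k / q k := fun k => div_nonneg (hr0 k) (hq0 k).le
  have hfB : ∀ k, r k / q k ≤ B * C.card / γ := fun k => by
    have hB : 0 ≤ B := (hr0 k).trans (hrB k)
    calc r k / q k ≤ B / (γ / C.card) :=
          div_le_div₀ hB (hrB k) (div_pos hγ0 hCc) (hqγ k)
      _ = B * C.card / γ := by rw [div_div_eq_mul_div]
  have hg0 : ∀ s : Finset ι, 0 ≤ ∑ k ∈ s, r k / q k := fun s =>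
    Finset.sum_nonneg fun k _ => hf0 k
  have hg1 : ∀ s ∈ S, η * ∑ k ∈ s, r k / q k ≤ 1 := fun s hs => by
    have h := Finset.sum_le_card_nsmul s _ _ fun k _ => hfB k
    rw [hSl s hs, nsmul_eq_mul] at h
    calc η * ∑ k ∈ s, r k / q k ≤ η * (l * (B * C.card / γ)) :=
          mul_le_mul_of_nonneg_left h hη.le
      _ = η * (l * B) * C.card / γ := by ring
      _ ≤ 1 := (div_le_one hγ0).mpr hηB
  refine (log_sum_mul_exp_div_sum_le S hS w _ (fun s _ => hw s)
    (fun s _ => mul_nonneg hη.le (hg0 s)) hg1).trans ?_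
  have hmean : ∑ s ∈ S, p s * ∑ k ∈ s, r k / q k = ∑ k, r k := by
    rw [sum_mul_sum_mem_eq]
    refine Finset.sum_congr rfl fun k _ => ?_
    rw [← hq, mul_div_cancel₀ _ (hq0 k).ne']
  have hsq : ∑ s ∈ S, p s * ∑ k ∈ s, (r k / q k) ^ 2 ≤ B * ∑ s ∈ C, ∑ k ∈ s, r k / q k := by
    rw [sum_mul_sum_mem_eq]
    calc ∑ k, (∑ s ∈ S.filter (fun s => k ∈ s), p s) * (r k / q k) ^ 2
        ≤ ∑ k, B * (r k / q k) := by
          refine Finset.sum_le_sum fun k _ => ?_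
          have h : q k * (r k / q k) ^ 2 = r k * (r k / q k) := by
            have := (hq0 k).ne'
            field_simp
          rw [← hq, h]
          exact mul_le_mul_of_nonneg_right (hrB k) (hf0 k)
      _ ≤ B * ∑ s ∈ C, ∑ k ∈ s, r k / q k := by
          simp_rw [Finset.mul_sum]
          exact sum_le_sum_sum_of_cover C hC (fun k => B * (r k / q k))
            fun k => mul_nonneg ((hr0 k).trans (hrB k)) (hf0 k)
  have hterm : ∀ s ∈ S, w s / (∑ t ∈ S, w t) *
      (η * ∑ k ∈ s, r k / q k + (η * ∑ k ∈ s, r k / q k) ^ 2) ≤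
      η / (1 - γ) * (p s * ∑ k ∈ s, r k / q k) +
        η ^ 2 * l / (1 - γ) * (p s * ∑ k ∈ s, (r k / q k) ^ 2) := fun s hs => by
    have hcs : (∑ k ∈ s, r k / q k) ^ 2 ≤ l * ∑ k ∈ s, (r k / q k) ^ 2 := by
      rw [← hSl s hs]
      exact sq_sum_le_card_mul_sum_sq
    have hwp : w s / (∑ t ∈ S, w t) ≤ p s / (1 - γ) := by
      rw [le_div_iff₀ hγ']
      calc w s / (∑ t ∈ S, w t) * (1 - γ) = (1 - γ) * w s / (∑ t ∈ S, w t) := by ring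
        _ ≤ p s := hpw s
    calc _ ≤ p s / (1 - γ) *
          (η * ∑ k ∈ s, r k / q k + η ^ 2 * (l * ∑ k ∈ s, (r k / q k) ^ 2)) := by
          refine mul_le_mul hwp ?_ ?_ (div_nonneg (hp0 s) hγ'.le)
          · rw [mul_pow]
            gcongr
          · have := mul_nonneg hη.le (hg0 s)
            positivity
      _ = _ := by ring
  refine (Finset.sum_le_sum hterm).trans ?_
  rw [Finset.sum_add_distrib, ← Finset.mul_sum, ← Finset.mul_sum, hmean]
  have h := mul_le_mul_of_nonneg_left hsq (show 0 ≤ η ^ 2 * l / (1 - γ) by positivity)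
  calc _ ≤ _ := add_le_add_right h _
    _ = _ := by ring

/-- In SpecWatch-III, if `γ ∈ (0,1/2)`, `β ∈ (0,1)`, and `η > 0` satisfies
`2·η·l·C ≤ γ`, then `ln(W (J+1)/W 1) ≤ (η/(1−γ))·(Ḡ_III + J·K·β) +
(η²·l·(1+β)/(1−γ))·∑_{j=1}^J ∑_{s∈𝒞} g' j s`, where
`Ḡ_III = ∑_{j=1}^J ∑_{k ∈ Z j} fbar k j`. -/
theorem stmt_13
    (K l J : ℕ) (hK : 1 ≤ K) (hl : 1 ≤ l) (hlK : l ≤ K) (hJ : 1 ≤ J)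
    (𝒮 : Finset (Finset (Fin K))) (h𝒮 : 𝒮 = Finset.powersetCard l Finset.univ)
    (𝒞 : Finset (Finset (Fin K))) (h𝒞sub : 𝒞 ⊆ 𝒮)
    (h𝒞cover : ∀ k : Fin K, ∃ s ∈ 𝒞, k ∈ s)
    (γ β η : ℝ) (hγ : γ ∈ Set.Ioo (0 : ℝ) (1 / 2)) (hβ : β ∈ Set.Ioo (0 : ℝ) 1)
    (hη : 0 < η) (hηlC : 2 * η * l * 𝒞.card ≤ γ)
    (Z : ℕ → Finset (Fin K)) (hZ : ∀ j, Z j ∈ 𝒮)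
    (fbar : Fin K → ℕ → ℝ) (hfbar : ∀ k j, fbar k j ∈ Set.Icc (0 : ℝ) 1)
    (hfbar0 : ∀ k j, k ∉ Z j → fbar k j = 0)
    (w : ℕ → Finset (Fin K) → ℝ) (W : ℕ → ℝ)
    (p : ℕ → Finset (Fin K) → ℝ) (q : ℕ → Fin K → ℝ)
    (f' : ℕ → Fin K → ℝ) (g' : ℕ → Finset (Fin K) → ℝ)
    (hw1 : ∀ s, w 1 s = 1)
    (hwrec : ∀ j s, w (j + 1) s = w j s * Real.exp (η * g' j s))
    (hW : ∀ j, W j = ∑ s ∈ 𝒮, w j s)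
    (hp : ∀ j s, p j s =
      (1 - γ) * w j s / W j + γ / 𝒞.card * (if s ∈ 𝒞 then 1 else 0))
    (hq : ∀ j k, q j k = ∑ s ∈ 𝒮.filter (fun s => k ∈ s), p j s)
    (hf' : ∀ j k, f' j k = ((if k ∈ Z j then fbar k j else 0) + β) / q j k)
    (hg' : ∀ j s, g' j s = ∑ k ∈ s, f' j k) :
    Real.log (W (J + 1) / W 1) ≤
      η / (1 - γ) * ((∑ j ∈ Finset.Icc 1 J, ∑ k ∈ Z j, fbar k j) + J * K * β) +
      η ^ 2 * l * (1 + β) / (1 - γ) * ∑ j ∈ Finset.Icc 1 J, ∑ s ∈ 𝒞, g' j s := by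
  obtain ⟨hγ0, hγ2⟩ := hγ
  obtain ⟨hβ0, hβ1⟩ := hβ
  have hS : 𝒮.Nonempty := ⟨Z 0, hZ 0⟩
  have hSl : ∀ s ∈ 𝒮, s.card = l := fun s hs => by
    rw [h𝒮] at hs
    exact (Finset.mem_powersetCard.mp hs).2
  have hCne : 𝒞.Nonempty := by
    obtain ⟨s, hs, -⟩ := h𝒞cover ⟨0, hK⟩
    exact ⟨s, hs⟩
  have hw : ∀ j, 1 ≤ j → ∀ s, 0 < w j s := by
    intro j hj
    induction j, hj using Nat.le_induction with
    | base => exact fun s => by simp [hw1]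
    | succ j _ ih =>
      intro s
      rw [hwrec]
      exact mul_pos (ih s) (Real.exp_pos _)
  have hWpos : ∀ j, 1 ≤ j → 0 < W j := fun j hj => by
    rw [hW]
    exact Finset.sum_pos (fun s _ => hw j hj s) hS
  have hZr : ∀ j k, (if k ∈ Z j then fbar k j else 0) = fbar k j := fun j k => by
    split_ifs with h
    · rfl
    · exact (hfbar0 k j h).symm
  have hbatch : ∀ j, 1 ≤ j → Real.log (W (j + 1) / W j) ≤
      η / (1 - γ) * (∑ k ∈ Z j, fbar k j + K * β) +
        η ^ 2 * l * (1 + β) / (1 - γ) * ∑ s ∈ 𝒞, g' j s := fun j hj => by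
    have hB : η * (l * (1 + β)) * 𝒞.card ≤ γ := by
      have : 0 ≤ η * l * 𝒞.card := by positivity
      nlinarith
    have h := log_weight_ratio_le 𝒮 𝒞 l hSl hS h𝒞sub hCne h𝒞cover γ η (1 + β) hγ0
      (by linarith) hη hB (w j) (p j) (q j) (fun k => fbar k j + β) (hw j hj)
      (fun s => by rw [hp, hW]) (hq j)
      (fun k => add_nonneg (hfbar k j).1 hβ0.le)
      (fun k => by linarith [(hfbar k j).2])
    have hr : ∑ k, (fbar k j + β) = ∑ k ∈ Z j, fbar k j + K * β := by
      rw [Finset.sum_add_distrib, Finset.sum_subset (Finset.subset_univ (Z j))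
        fun k _ hk => hfbar0 k j hk]
      simp
    have hg : ∀ s, ∑ k ∈ s, (fbar k j + β) / q j k = g' j s := fun s => by
      rw [hg']
      exact Finset.sum_congr rfl fun k _ => by rw [hf', hZr]
    simp only [hr, hg, ← hwrec, ← hW] at h
    exact h
  clear hJ
  induction J with
  | zero => simp [(hWpos 1 le_rfl).ne']
  | succ J ih =>
    have hJ1 : 1 ≤ J + 1 := Nat.le_add_left 1 J
    have hsplit : Real.log (W (J + 1 + 1) / W 1) =
        Real.log (W (J + 1) / W 1) + Real.log (W (J + 1 + 1) / W (J + 1)) := by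
      have h1 := (hWpos 1 le_rfl).ne'
      have h2 := (hWpos (J + 1) hJ1).ne'
      have h3 := (hWpos (J + 1 + 1) (Nat.le_add_left 1 _)).ne'
      rw [Real.log_div h3 h1, Real.log_div h2 h1, Real.log_div h3 h2]
      ring
    rw [hsplit, Finset.sum_Icc_succ_top hJ1, Finset.sum_Icc_succ_top hJ1]
    refine (add_le_add ih (hbatch (J + 1) hJ1)).trans_eq ?_
    push_cast
    ring
end

section
/- In SpecWatch-III, if γ ∈ (0,1/2), β ∈ (0,1), and η > 0 satisfies 2·η·l·C ≤ γ, then for any realization of the chosen strategies and rewards the following deterministic inequality holds: Ḡ_III ≥ (1 − γ − η·l·(1+β)·C)·max_{s∈𝒮} Σ_{j=1}^J ḡ′_{s,j} − ((1−γ)/η)·ln S − J·K·β, where Ḡ_III = Σ_{j=1}^J ḡ_{Z_j,j}. -/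
open Finset Real

theorem Real.exp_le_one_add_add_sq_s15 {x : ℝ} (h0 : 0 ≤ x) (h1 : x ≤ 1) :
    Real.exp x ≤ 1 + x + x ^ 2 := by
  have h := (abs_le.1 (Real.abs_exp_sub_one_sub_id_le (abs_le.2 ⟨by linarith, h1⟩))).2
  linarith

theorem sum_mul_sum_mem_eq_sum_marginal_mul {α : Type*} [Fintype α] [DecidableEq α]
    (A : Finset (Finset α)) (p : Finset α → ℝ) (x : α → ℝ) :
    ∑ s ∈ A, p s * ∑ k ∈ s, x k = ∑ k, (∑ s ∈ A with k ∈ s, p s) * x k := by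
  simp_rw [Finset.mul_sum, Finset.sum_mul, Finset.sum_filter]
  rw [Finset.sum_comm (s := univ)]
  refine Finset.sum_congr rfl fun s _ => ?_
  rw [← Finset.sum_filter]
  simp

theorem sum_le_sum_sum_of_cover_s15 {α : Type*} [Fintype α] [DecidableEq α]
    {A : Finset (Finset α)} (hA : ∀ k, ∃ s ∈ A, k ∈ s) {x : α → ℝ} (hx : ∀ k, 0 ≤ x k) :
    ∑ k, x k ≤ ∑ s ∈ A, ∑ k ∈ s, x k := by
  have h := sum_mul_sum_mem_eq_sum_marginal_mul A (fun _ => 1) x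
  simp only [one_mul] at h
  rw [h]
  refine Finset.sum_le_sum fun k _ => le_mul_of_one_le_left (hx k) ?_
  obtain ⟨s, hs, hk⟩ := hA k
  exact Finset.single_le_sum (f := fun _ => (1 : ℝ)) (fun _ _ => zero_le_one)
    (Finset.mem_filter.2 ⟨hs, hk⟩)

/-- One step of the exponential-weights potential argument. -/
theorem log_sum_mul_exp_sub_log_sum_le {ι : Type*} {A : Finset ι} (hA : A.Nonempty)
    {w p g : ι → ℝ} {γ η : ℝ} (hγ : γ < 1) (hη : 0 ≤ η) (hw : ∀ i ∈ A, 0 < w i)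
    (hp : ∀ i ∈ A, (1 - γ) * w i / (∑ i ∈ A, w i) ≤ p i) (hg : ∀ i ∈ A, 0 ≤ g i)
    (hg1 : ∀ i ∈ A, η * g i ≤ 1) :
    (1 - γ) * (Real.log (∑ i ∈ A, w i * Real.exp (η * g i)) - Real.log (∑ i ∈ A, w i)) ≤
      η * ∑ i ∈ A, p i * g i + η ^ 2 * ∑ i ∈ A, p i * g i ^ 2 := by
  set W := ∑ i ∈ A, w i with hW
  have hWpos : 0 < W := Finset.sum_pos hw hA
  have hnum : 0 < ∑ i ∈ A, w i * Real.exp (η * g i) :=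
    Finset.sum_pos (fun i hi => mul_pos (hw i hi) (Real.exp_pos _)) hA
  rw [← Real.log_div hnum.ne' hWpos.ne']
  calc (1 - γ) * Real.log ((∑ i ∈ A, w i * Real.exp (η * g i)) / W)
      ≤ (1 - γ) * ((∑ i ∈ A, w i * Real.exp (η * g i)) / W - 1) := by
        gcongr
        exact Real.log_le_sub_one_of_pos (div_pos hnum hWpos)
    _ = ∑ i ∈ A, (1 - γ) * w i / W * (Real.exp (η * g i) - 1) := by
        simp_rw [mul_sub, mul_one, Finset.sum_sub_distrib, ← Finset.sum_div, ← Finset.mul_sum,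
          ← hW]
        rw [Finset.sum_congr rfl fun i _ => show (1 - γ) * w i / W * Real.exp (η * g i) =
          (1 - γ) / W * (w i * Real.exp (η * g i)) by ring, ← Finset.mul_sum]
        field_simp
    _ ≤ ∑ i ∈ A, p i * (η * g i + (η * g i) ^ 2) := by
        refine Finset.sum_le_sum fun i hi => ?_
        have h0 : 0 ≤ η * g i := mul_nonneg hη (hg i hi)
        have hq : 0 ≤ (1 - γ) * w i / W :=
          div_nonneg (mul_nonneg (by linarith) (hw i hi).le) hWpos.le
        refine mul_le_mul (hp i hi) ?_ ?_ (hq.trans (hp i hi))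
        · linarith [Real.exp_le_one_add_add_sq_s15 h0 (hg1 i hi)]
        · linarith [Real.add_one_le_exp (η * g i)]
    _ = η * ∑ i ∈ A, p i * g i + η ^ 2 * ∑ i ∈ A, p i * g i ^ 2 := by
        rw [Finset.mul_sum, Finset.mul_sum, ← Finset.sum_add_distrib]
        exact Finset.sum_congr rfl fun i _ => by ring

theorem sum_Icc_one_succ_sub (a : ℕ → ℝ) (n : ℕ) :
    ∑ j ∈ Finset.Icc 1 n, (a (j + 1) - a j) = a (n + 1) - a 1 := by
  induction n with
  | zero => simp
  | succ n ih => rw [Finset.sum_Icc_succ_top (by omega), ih]; ring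

/-- In SpecWatch-III, if `γ ∈ (0,1/2)`, `β ∈ (0,1)`, and `η > 0` satisfies
`2·η·l·C ≤ γ`, then for any realization
`Ḡ_III ≥ (1 − γ − η·l·(1+β)·C)·max_{s∈𝒮} ∑_{j=1}^J g' j s − ((1−γ)/η)·ln S − J·K·β`,
where `Ḡ_III = ∑_{j=1}^J ∑_{k ∈ Z j} fbar k j`. -/
theorem stmt_15
    (K l J : ℕ) (hK : 1 ≤ K) (hl : 1 ≤ l) (hlK : l ≤ K) (hJ : 1 ≤ J)
    (𝒮 : Finset (Finset (Fin K))) (h𝒮 : 𝒮 = Finset.powersetCard l Finset.univ)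
    (h𝒮ne : 𝒮.Nonempty)
    (𝒞 : Finset (Finset (Fin K))) (h𝒞sub : 𝒞 ⊆ 𝒮)
    (h𝒞cover : ∀ k : Fin K, ∃ s ∈ 𝒞, k ∈ s)
    (γ β η : ℝ) (hγ : γ ∈ Set.Ioo (0 : ℝ) (1 / 2)) (hβ : β ∈ Set.Ioo (0 : ℝ) 1)
    (hη : 0 < η) (hηlC : 2 * η * l * 𝒞.card ≤ γ)
    (Z : ℕ → Finset (Fin K)) (hZ : ∀ j, Z j ∈ 𝒮)
    (fbar : Fin K → ℕ → ℝ) (hfbar : ∀ k j, fbar k j ∈ Set.Icc (0 : ℝ) 1)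
    (hfbar0 : ∀ k j, k ∉ Z j → fbar k j = 0)
    (w : ℕ → Finset (Fin K) → ℝ) (W : ℕ → ℝ)
    (p : ℕ → Finset (Fin K) → ℝ) (q : ℕ → Fin K → ℝ)
    (f' : ℕ → Fin K → ℝ) (g' : ℕ → Finset (Fin K) → ℝ)
    (hw1 : ∀ s, w 1 s = 1)
    (hwrec : ∀ j s, w (j + 1) s = w j s * Real.exp (η * g' j s))
    (hW : ∀ j, W j = ∑ s ∈ 𝒮, w j s)
    (hp : ∀ j s, p j s =
      (1 - γ) * w j s / W j + γ / 𝒞.card * (if s ∈ 𝒞 then 1 else 0))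
    (hq : ∀ j k, q j k = ∑ s ∈ 𝒮.filter (fun s => k ∈ s), p j s)
    (hf' : ∀ j k, f' j k = ((if k ∈ Z j then fbar k j else 0) + β) / q j k)
    (hg' : ∀ j s, g' j s = ∑ k ∈ s, f' j k) :
    ∑ j ∈ Finset.Icc 1 J, ∑ k ∈ Z j, fbar k j ≥
      (1 - γ - η * l * (1 + β) * 𝒞.card) *
          (𝒮.sup' h𝒮ne fun s => ∑ j ∈ Finset.Icc 1 J, g' j s) -
        (1 - γ) / η * Real.log 𝒮.card - J * K * β := by
  obtain ⟨hγ0, hγ1⟩ := hγ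
  obtain ⟨hβ0, hβ1⟩ := hβ
  have hcardS : ∀ s ∈ 𝒮, s.card = l := fun s hs => by
    rw [h𝒮] at hs
    exact (Finset.mem_powersetCard.1 hs).2
  have hl0 : (0 : ℝ) < l := by exact_mod_cast hl
  have hC : (0 : ℝ) < 𝒞.card := by
    obtain ⟨s, hs, _⟩ := h𝒞cover ⟨0, hK⟩
    exact_mod_cast Finset.card_pos.2 ⟨s, hs⟩
  have hw_exp : ∀ n s, w (n + 1) s = Real.exp (η * ∑ j ∈ Finset.Icc 1 n, g' j s) := by
    intro n s
    induction n with
    | zero => simp [hw1]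
    | succ n ih =>
      rw [hwrec, ih, Finset.sum_Icc_succ_top (by omega), mul_add, Real.exp_add]
  have hwpos : ∀ j, 1 ≤ j → ∀ s, 0 < w j s := by
    rintro (_ | j) hj s
    · omega
    · rw [hw_exp]; exact Real.exp_pos _
  have hWpos : ∀ j, 1 ≤ j → 0 < W j := fun j hj => by
    rw [hW]; exact Finset.sum_pos (fun s _ => hwpos j hj s) h𝒮ne
  have hexploit : ∀ j, 1 ≤ j → ∀ s, 0 ≤ (1 - γ) * w j s / W j := fun j hj s =>
    div_nonneg (mul_nonneg (by linarith) (hwpos j hj s).le) (hWpos j hj).le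
  have hexplore : ∀ s, 0 ≤ γ / 𝒞.card * (if s ∈ 𝒞 then (1 : ℝ) else 0) := fun s => by
    split_ifs <;> positivity
  have hp0 : ∀ j, 1 ≤ j → ∀ s, 0 ≤ p j s := fun j hj s => by
    rw [hp]; exact add_nonneg (hexploit j hj s) (hexplore s)
  have hq_lb : ∀ j, 1 ≤ j → ∀ k, γ / 𝒞.card ≤ q j k := by
    intro j hj k
    obtain ⟨s, hs, hk⟩ := h𝒞cover k
    have hps : γ / 𝒞.card ≤ p j s := by
      rw [hp, if_pos hs, mul_one]
      linarith [hexploit j hj s]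
    rw [hq]
    exact hps.trans (Finset.single_le_sum (f := p j) (fun s _ => hp0 j hj s)
      (Finset.mem_filter.2 ⟨h𝒞sub hs, hk⟩))
  have hqpos : ∀ j, 1 ≤ j → ∀ k, 0 < q j k := fun j hj k =>
    (div_pos hγ0 hC).trans_le (hq_lb j hj k)
  have hqf : ∀ j, 1 ≤ j → ∀ k, q j k * f' j k = fbar k j + β := by
    intro j hj k
    have hif : (if k ∈ Z j then fbar k j else 0) = fbar k j := by
      split_ifs with hk
      · rfl
      · exact (hfbar0 k j hk).symm
    rw [hf', hif, mul_div_cancel₀ _ (hqpos j hj k).ne']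
  have hf0 : ∀ j, 1 ≤ j → ∀ k, 0 ≤ f' j k := fun j hj k => by
    refine nonneg_of_mul_nonneg_right ?_ (hqpos j hj k)
    rw [hqf j hj k]
    linarith [(hfbar k j).1]
  have hf_ub : ∀ j, 1 ≤ j → ∀ k, η * l * f' j k ≤ 1 := by
    intro j hj k
    have h1 : γ / 𝒞.card * f' j k ≤ 2 := by
      have := mul_le_mul_of_nonneg_right (hq_lb j hj k) (hf0 j hj k)
      rw [hqf j hj k] at this
      linarith [(hfbar k j).2]
    have h2 : 2 * η * l ≤ γ / 𝒞.card := (le_div_iff₀ hC).2 hηlC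
    nlinarith [mul_le_mul_of_nonneg_right h2 (hf0 j hj k)]
  have hg0 : ∀ j, 1 ≤ j → ∀ s, 0 ≤ g' j s := fun j hj s => by
    rw [hg']; exact Finset.sum_nonneg fun k _ => hf0 j hj k
  have hg_ub : ∀ j, 1 ≤ j → ∀ s ∈ 𝒮, η * g' j s ≤ 1 := by
    intro j hj s hs
    have h := Finset.sum_le_card_nsmul s (fun k => η * l * f' j k) 1 fun k _ => hf_ub j hj k
    rw [← Finset.mul_sum, ← hg', hcardS s hs, nsmul_eq_mul] at h
    refine le_of_mul_le_mul_left ?_ hl0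
    linarith
  set M := 𝒮.sup' h𝒮ne fun s => ∑ j ∈ Finset.Icc 1 J, g' j s with hM
  have hfirst : ∀ j, 1 ≤ j → ∑ s ∈ 𝒮, p j s * g' j s = ∑ k ∈ Z j, fbar k j + K * β := by
    intro j hj
    simp_rw [hg']
    rw [sum_mul_sum_mem_eq_sum_marginal_mul]
    simp_rw [← hq, hqf j hj]
    rw [Finset.sum_add_distrib, Finset.sum_subset (Finset.subset_univ (Z j))
      fun k _ hk => hfbar0 k j hk]
    simp
  have hsecond : ∀ j, 1 ≤ j →
      ∑ s ∈ 𝒮, p j s * g' j s ^ 2 ≤ l * (1 + β) * ∑ s ∈ 𝒞, g' j s := by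
    intro j hj
    calc ∑ s ∈ 𝒮, p j s * g' j s ^ 2
        ≤ ∑ s ∈ 𝒮, p j s * ∑ k ∈ s, l * f' j k ^ 2 := by
          refine Finset.sum_le_sum fun s hs => mul_le_mul_of_nonneg_left ?_ (hp0 j hj s)
          have h := sq_sum_le_card_mul_sum_sq (s := s) (f := f' j)
          rwa [hcardS s hs, ← hg', Finset.mul_sum] at h
      _ = ∑ k, q j k * (l * f' j k ^ 2) := by
          rw [sum_mul_sum_mem_eq_sum_marginal_mul]
          simp_rw [← hq]
      _ ≤ ∑ k, l * (1 + β) * f' j k := by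
          refine Finset.sum_le_sum fun k _ => ?_
          rw [show q j k * (l * f' j k ^ 2) = l * (q j k * f' j k) * f' j k by ring, hqf j hj k]
          have := hf0 j hj k
          gcongr
          linarith [(hfbar k j).2]
      _ = l * (1 + β) * ∑ k, f' j k := (Finset.mul_sum ..).symm
      _ ≤ l * (1 + β) * ∑ s ∈ 𝒞, g' j s := by
          simp_rw [hg']
          gcongr
          exact sum_le_sum_sum_of_cover_s15 h𝒞cover (hf0 j hj)
  have hstep : ∀ j ∈ Finset.Icc 1 J, (1 - γ) * (Real.log (W (j + 1)) - Real.log (W j)) ≤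
      η * (∑ k ∈ Z j, fbar k j + K * β) + η ^ 2 * (l * (1 + β) * ∑ s ∈ 𝒞, g' j s) := by
    intro j hj
    have hj := (Finset.mem_Icc.1 hj).1
    have h := log_sum_mul_exp_sub_log_sum_le (p := p j) h𝒮ne (by linarith : γ < 1) hη.le
      (fun s _ => hwpos j hj s) (fun s _ => by
        rw [← hW, hp]; linarith [hexplore s]) (fun s _ => hg0 j hj s) (hg_ub j hj)
    simp_rw [← hwrec, ← hW] at h
    rw [hfirst j hj] at h
    refine h.trans ?_
    gcongr
    exact hsecond j hj
  have hsum := Finset.sum_le_sum hstep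
  rw [← Finset.mul_sum, sum_Icc_one_succ_sub (fun j => Real.log (W j)), Finset.sum_add_distrib,
    ← Finset.mul_sum, ← Finset.mul_sum, ← Finset.mul_sum, Finset.sum_add_distrib,
    Finset.sum_comm (t := 𝒞)] at hsum
  have hcover : ∑ s ∈ 𝒞, ∑ j ∈ Finset.Icc 1 J, g' j s ≤ 𝒞.card * M := by
    rw [← nsmul_eq_mul]
    exact Finset.sum_le_card_nsmul _ _ _ fun s hs =>
      Finset.le_sup' (fun s => ∑ j ∈ Finset.Icc 1 J, g' j s) (h𝒞sub hs)
  have hW1 : W 1 = 𝒮.card := by simp [hW, hw1]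
  have hWJ : η * M ≤ Real.log (W (J + 1)) := by
    obtain ⟨s, hs, hsM⟩ := Finset.exists_mem_eq_sup' h𝒮ne fun s => ∑ j ∈ Finset.Icc 1 J, g' j s
    rw [hM, hsM, Real.le_log_iff_exp_le (hWpos _ (by omega)), ← hw_exp, hW]
    exact Finset.single_le_sum (fun s _ => (hwpos _ (by omega) s).le) hs
  have hmain : η * ((1 - γ) * M - (1 - γ) / η * Real.log 𝒮.card) ≤
      η * (∑ j ∈ Finset.Icc 1 J, ∑ k ∈ Z j, fbar k j + J * K * β
        + η * (l * (1 + β) * (𝒞.card * M))) := by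
    calc η * ((1 - γ) * M - (1 - γ) / η * Real.log 𝒮.card)
        = (1 - γ) * (η * M - Real.log (W 1)) := by rw [hW1]; field_simp
      _ ≤ (1 - γ) * (Real.log (W (J + 1)) - Real.log (W 1)) := by
          gcongr
          linarith
      _ ≤ _ := hsum
      _ ≤ η * (∑ j ∈ Finset.Icc 1 J, ∑ k ∈ Z j, fbar k j + J * K * β)
          + η ^ 2 * (l * (1 + β) * (𝒞.card * M)) := by
          simp only [Finset.sum_const, Nat.card_Icc, Nat.add_sub_cancel, nsmul_eq_mul, mul_assoc]
            at hcover ⊢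
          gcongr
      _ = _ := by ring
  linarith [le_of_mul_le_mul_left hmain hη]
end
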